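/- Let A be a weakly associative relation algebra. Then for all x, y, u, v ∈ A: if u ≤ 1' then (u;x);y = u;(x;y), and if u ≤ 1' and v ≤ 1' then (x;u);(v;y) ≤ x;((u·v);y). -/

import Mathlib

universe u

/-- A weakly associative relation algebra: a Boolean algebra equipped with
relative multiplication `comp`, converse `conv`, and identity `one'`
satisfying the WA axioms. -/
structure WA (A : Type*) [BooleanAlgebra A] where
  comp : A → A → A
  conv : A → A
  one' : A
  wassoc : ∀ x : A, comp (comp (x ⊓ one') ⊤) ⊤ = comp (x ⊓ one') ⊤
  rdist : ∀ x y z : A, comp (x ⊔ y) z = comp x z ⊔ comp y z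
  comp_one' : ∀ x : A, comp x one' = x
  conv_conv : ∀ x : A, conv (conv x) = x
  conv_sup : ∀ x y : A, conv (x ⊔ y) = conv x ⊔ conv y
  conv_comp : ∀ x y : A, conv (comp x y) = comp (conv y) (conv x)
  tarski : ∀ x y : A, comp (conv x) (comp x y)ᶜ ≤ yᶜ

namespace WA

variable {A : Type u} [BooleanAlgebra A] (W : WA A)

theorem conv_mono {x y : A} (h : x ≤ y) : W.conv x ≤ W.conv y := by
  rw [← sup_eq_right] at h ⊢
  rw [← W.conv_sup, h]

theorem conv_le_iff {x y : A} : W.conv x ≤ y ↔ x ≤ W.conv y :=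
  ⟨fun h => by simpa [W.conv_conv] using W.conv_mono h,
    fun h => by simpa [W.conv_conv] using W.conv_mono h⟩

theorem conv_bot : W.conv ⊥ = ⊥ := le_bot_iff.1 (W.conv_le_iff.2 bot_le)

theorem conv_top : W.conv ⊤ = ⊤ := top_le_iff.1 (W.conv_le_iff.1 le_top)

theorem disjoint_conv {x y : A} (h : Disjoint x y) : Disjoint (W.conv x) (W.conv y) := by
  intro z hx hy
  have := W.conv_le_iff.1 (h (W.conv_le_iff.2 hx) (W.conv_le_iff.2 hy))
  rwa [W.conv_bot] at this

theorem conv_one' : W.conv W.one' = W.one' := by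
  have h := W.conv_comp (W.conv W.one') W.one'
  rw [W.conv_conv, W.comp_one', W.conv_conv] at h
  exact h.symm

theorem one'_comp (x : A) : W.comp W.one' x = x := by
  rw [← W.conv_conv (W.comp W.one' x), W.conv_comp, W.conv_one', W.comp_one', W.conv_conv]

theorem comp_sup (x y z : A) : W.comp x (y ⊔ z) = W.comp x y ⊔ W.comp x z := by
  rw [← W.conv_conv (W.comp x (y ⊔ z)), W.conv_comp, W.conv_sup, W.rdist, W.conv_sup,
    W.conv_comp, W.conv_comp]
  simp only [W.conv_conv]

theorem comp_mono {x x' y y' : A} (hx : x ≤ x') (hy : y ≤ y') :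
    W.comp x y ≤ W.comp x' y' := by
  rw [← sup_eq_right.2 hx, ← sup_eq_right.2 hy, W.rdist, W.comp_sup]
  exact le_sup_left.trans le_sup_left

theorem comp_le_left {x u : A} (hu : u ≤ W.one') : W.comp x u ≤ x :=
  (W.comp_mono le_rfl hu).trans_eq (W.comp_one' x)

theorem comp_le_right {x u : A} (hu : u ≤ W.one') : W.comp u x ≤ x :=
  (W.comp_mono hu le_rfl).trans_eq (W.one'_comp x)

theorem disjoint_conv_comp {x y z : A} (h : Disjoint (W.comp x y) z) :
    Disjoint (W.comp (W.conv x) z) y :=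
  le_compl_iff_disjoint_right.1
    ((W.comp_mono le_rfl (le_compl_iff_disjoint_left.2 h)).trans (W.tarski x y))

theorem disjoint_comp_conv {x y z : A} (h : Disjoint (W.comp x y) z) :
    Disjoint (W.comp z (W.conv y)) x := by
  have h₁ := W.disjoint_conv h
  rw [W.conv_comp] at h₁
  have h₂ := W.disjoint_conv (W.disjoint_conv_comp h₁)
  simpa only [W.conv_comp, W.conv_conv] using h₂

theorem conv_le_of_le_one' {u : A} (hu : u ≤ W.one') : W.conv u ≤ u := by
  have hu' : W.conv u ≤ W.one' := by simpa [W.conv_one'] using W.conv_mono hu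
  have h : Disjoint (W.comp u W.one') (W.one' \ u) := by
    rw [W.comp_one']
    exact disjoint_sdiff_self_right
  have h₀ : W.comp (W.conv u) (W.one' \ u) = ⊥ :=
    (W.disjoint_conv_comp h).eq_bot_of_le ((W.comp_le_left sdiff_le).trans hu')
  calc W.conv u = W.comp (W.conv u) (u ⊔ W.one' \ u) := by
        rw [sup_sdiff_cancel_right hu, W.comp_one']
    _ = W.comp (W.conv u) u := by rw [W.comp_sup, h₀, sup_bot_eq]
    _ ≤ u := W.comp_le_right hu'

theorem conv_eq_of_le_one' {u : A} (hu : u ≤ W.one') : W.conv u = u :=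
  le_antisymm (W.conv_le_of_le_one' hu) (W.conv_le_iff.1 (W.conv_le_of_le_one' hu))

theorem comp_top_comp_top {u : A} (hu : u ≤ W.one') :
    W.comp (W.comp u ⊤) ⊤ = W.comp u ⊤ := by
  simpa only [inf_eq_left.2 hu] using W.wassoc u

theorem comp_comp_le {u : A} (hu : u ≤ W.one') (x y : A) :
    W.comp (W.comp u x) y ≤ W.comp u ⊤ :=
  (W.comp_mono (W.comp_mono le_rfl le_top) le_top).trans_eq (W.comp_top_comp_top hu)

theorem disjoint_comp_top {u v : A} (hu : u ≤ W.one') (hv : v ≤ W.one') (h : Disjoint u v) :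
    Disjoint (W.comp u ⊤) (W.comp v ⊤) := by
  have h₁ : Disjoint (W.comp (W.conv u) v) ⊤ := by
    rw [W.conv_eq_of_le_one' hu, disjoint_top]
    exact le_bot_iff.1 (h (W.comp_le_left hv) (W.comp_le_right hu))
  have h₂ := W.disjoint_conv_comp h₁
  rw [W.conv_conv, ← W.comp_top_comp_top hu] at h₂
  simpa only [W.conv_top] using (W.disjoint_comp_conv h₂).symm

theorem comp_eq_inf {u : A} (hu : u ≤ W.one') (x : A) : W.comp u x = x ⊓ W.comp u ⊤ := by
  apply le_antisymm (le_inf (W.comp_le_right hu) (W.comp_mono le_rfl le_top))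
  have hd := W.disjoint_comp_top hu sdiff_le disjoint_sdiff_self_right
  have hx : x = W.comp u x ⊔ W.comp (W.one' \ u) x := by
    rw [← W.rdist, sup_sdiff_cancel_right hu, W.one'_comp]
  have h₀ := (hd.symm.mono_left (W.comp_mono le_rfl (le_top (a := x)))).eq_bot
  conv_lhs => rw [hx, inf_sup_right, h₀, sup_bot_eq]
  exact inf_le_left

theorem comp_comp_eq {u : A} (hu : u ≤ W.one') (x y : A) :
    W.comp (W.comp u x) y = W.comp u (W.comp x y) := by
  rw [W.comp_eq_inf hu (W.comp x y)]
  apply le_antisymm (le_inf (W.comp_mono (W.comp_le_right hu) le_rfl) (W.comp_comp_le hu x y))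
  have hd := W.disjoint_comp_top hu sdiff_le disjoint_sdiff_self_right
  have hx : W.comp x y = W.comp (W.comp u x) y ⊔ W.comp (W.comp (W.one' \ u) x) y := by
    rw [← W.rdist, ← W.rdist, sup_sdiff_cancel_right hu, W.one'_comp]
  have h₀ := (hd.symm.mono_left (W.comp_comp_le sdiff_le x y)).eq_bot
  rw [hx, inf_sup_right, h₀, sup_bot_eq]
  exact inf_le_left

theorem comp_comp_comp_eq_bot {u v : A} (hu : u ≤ W.one') (hv : v ≤ W.one') (h : Disjoint u v)
    (x y : A) : W.comp (W.comp x u) (W.comp v y) = ⊥ := by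
  have h₁ : Disjoint (W.comp (W.conv (W.comp x u)) ⊤) (W.comp v y) := by
    rw [W.conv_comp, W.conv_eq_of_le_one' hu]
    exact (W.disjoint_comp_top hu hv h).mono (W.comp_comp_le hu _ _)
      (W.comp_mono le_rfl le_top)
  have h₂ := W.disjoint_conv_comp h₁
  rwa [W.conv_conv, disjoint_top] at h₂

theorem comp_comp_comp_le {u v : A} (hu : u ≤ W.one') (hv : v ≤ W.one') (x y : A) :
    W.comp (W.comp x u) (W.comp v y) ≤ W.comp x (W.comp (u ⊓ v) y) := by
  have hd : Disjoint u (v \ u) := disjoint_sdiff_self_right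
  have hs : v = u ⊓ v ⊔ v \ u := by rw [inf_comm, sup_inf_sdiff]
  conv_lhs => rw [hs, W.rdist, W.comp_sup,
    W.comp_comp_comp_eq_bot hu (sdiff_le.trans hv) hd, sup_bot_eq]
  exact W.comp_mono (W.comp_le_left hu) le_rfl

end WA

/-- Associativity laws for subidentity elements in a WA. -/
theorem stmt_18 {A : Type u} [BooleanAlgebra A] (W : WA A) :
    ∀ x y u v : A,
      (u ≤ W.one' → W.comp (W.comp u x) y = W.comp u (W.comp x y)) ∧
      (u ≤ W.one' → v ≤ W.one' →
        W.comp (W.comp x u) (W.comp v y) ≤ W.comp x (W.comp (u ⊓ v) y)) :=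
  fun x y _ _ => ⟨fun hu => W.comp_comp_eq hu x y, fun hu hv => W.comp_comp_comp_le hu hv x y⟩
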